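/- As n → ∞ along integers n such that n+1 is NOT divisible by 4, the probability that a uniformly random Littlewood polynomial of degree n has a double root is o(n^{-2}); that is, n² · N_n / 2^{n+1} → 0 along this subsequence. -/

import Mathlib

open Filter

/-- The polynomial `∑_{j=0}^n a_j z^j` with integer coefficients, viewed over `ℂ`. -/
noncomputable def polyOf (n : ℕ) (a : Fin (n + 1) → ℤ) : Polynomial ℂ :=
  ∑ j : Fin (n + 1), Polynomial.C (a j : ℂ) * Polynomial.X ^ (j : ℕ)

/-- The polynomial with coefficients `a` has a double root in `ℂ`. -/
def hasDoubleRoot (n : ℕ) (a : Fin (n + 1) → ℤ) : Prop :=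
  ∃ z : ℂ, (polyOf n a).eval z = 0 ∧ (Polynomial.derivative (polyOf n a)).eval z = 0

/-- `N_n`: the number of sign vectors `(a_0, …, a_n) ∈ {-1,1}^{n+1}` such that the
Littlewood polynomial `∑ a_j z^j` has a double root in `ℂ`. -/
noncomputable def littlewoodDoubleRootCount (n : ℕ) : ℕ :=
  Nat.card {a : Fin (n + 1) → ℤ // (∀ j, a j = 1 ∨ a j = -1) ∧ hasDoubleRoot n a}


namespace LW

/-- sign of a boolean -/
def sg (b : Bool) : ℤ := if b then 1 else -1

lemma sg_inj {a b : Bool} (h : sg a = sg b) : a = b := by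
  revert h; cases a <;> cases b <;> simp [sg]

open Classical in
lemma cond_count {ι κ : Type*} [Fintype ι] [Fintype κ] (e : κ → ι) (he : Function.Injective e)
    (E : Finset (ι → Bool)) (c : ℕ)
    (h : ∀ ω : ι → Bool,
      (Finset.univ.filter (fun x : κ → Bool => Function.extend e x ω ∈ E)).card ≤ c) :
    E.card * 2 ^ Fintype.card κ ≤ c * 2 ^ Fintype.card ι := by
  have h1 : (E ×ˢ (Finset.univ : Finset (κ → Bool))).card ≤
      (Finset.univ.sigma (fun ω : ι → Bool =>
        Finset.univ.filter (fun x : κ → Bool => Function.extend e x ω ∈ E))).card := by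
    apply Finset.card_le_card_of_injOn
      (fun p => (⟨Function.extend e p.2 p.1, fun k => p.1 (e k)⟩ : Σ _ : ι → Bool, κ → Bool))
    · rintro ⟨η, y⟩ hp
      simp only [Finset.coe_product, Set.mem_prod, Finset.mem_coe] at hp
      simp only [Finset.coe_sigma, Set.mem_sigma_iff, Finset.mem_coe, Finset.mem_univ,
        Finset.mem_filter, true_and]
      convert hp.1 using 1
      funext i
      by_cases hi : ∃ k, e k = i
      · obtain ⟨k, rfl⟩ := hi
        rw [he.extend_apply]
      · rw [Function.extend_apply' _ _ _ hi, Function.extend_apply' _ _ _ hi]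
    · rintro ⟨η, y⟩ _ ⟨η', y'⟩ _ heq
      simp only [Sigma.mk.injEq, heq_eq_eq] at heq
      obtain ⟨h1, h2⟩ := heq
      have hy : y = y' := by
        funext k
        have := congrFun h1 (e k)
        rwa [he.extend_apply, he.extend_apply] at this
      have hη : η = η' := by
        funext i
        by_cases hi : ∃ k, e k = i
        · obtain ⟨k, rfl⟩ := hi
          exact congrFun h2 k
        · have := congrFun h1 i
          rwa [Function.extend_apply' _ _ _ hi, Function.extend_apply' _ _ _ hi] at this
      rw [hy, hη]
  rw [Finset.card_product, Finset.card_sigma] at h1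
  have h2 := Finset.sum_le_card_nsmul (Finset.univ : Finset (ι → Bool)) _ c (fun ω _ => h ω)
  simp only [Finset.card_univ, Fintype.card_fun, Fintype.card_bool, smul_eq_mul] at h1 h2
  calc _ ≤ _ := h1
    _ ≤ _ := h2
    _ = _ := by ring

lemma extend_diff {ι κ R : Type*} [Fintype ι] [Fintype κ] [CommRing R] (e : κ → ι)
    (he : Function.Injective e) (ω : ι → Bool) (x y : κ → Bool) (F : ι → R) :
    ∑ i, (sg (Function.extend e x ω i) : R) * F i - ∑ i, (sg (Function.extend e y ω i) : R) * F i
      = ∑ k, ((sg (x k) : R) - (sg (y k) : R)) * F (e k) := by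
  classical
  rw [← Finset.sum_sub_distrib]
  rw [← Finset.sum_subset (Finset.subset_univ (Finset.univ.image e))]
  · rw [Finset.sum_image (fun a _ b _ h => he h)]
    apply Finset.sum_congr rfl
    intro k _
    rw [he.extend_apply, he.extend_apply]; ring
  · intro i _ hi
    have hi' : ¬ ∃ k, e k = i := by simpa using hi
    rw [Function.extend_apply' _ _ _ hi', Function.extend_apply' _ _ _ hi']; ring

lemma centralBinom_sq (m : ℕ) : (Nat.centralBinom m) ^ 2 * (2 * m + 1) ≤ 16 ^ m := by
  induction m with
  | zero => simp
  | succ m ih =>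
    have h := Nat.succ_mul_centralBinom_succ m
    have h2 : (m + 1) ^ 2 * ((Nat.centralBinom (m + 1)) ^ 2 * (2 * (m + 1) + 1)) ≤
        (m + 1) ^ 2 * 16 ^ (m + 1) := by
      calc (m + 1) ^ 2 * ((Nat.centralBinom (m + 1)) ^ 2 * (2 * (m + 1) + 1))
          = ((m + 1) * Nat.centralBinom (m + 1)) ^ 2 * (2 * m + 3) := by ring
        _ = (Nat.centralBinom m ^ 2 * (2 * m + 1)) * (4 * (2 * m + 1) * (2 * m + 3)) := by
            rw [h]; ring
        _ ≤ 16 ^ m * (16 * (m + 1) ^ 2) := Nat.mul_le_mul ih (by nlinarith)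
        _ = _ := by ring
    exact Nat.le_of_mul_le_mul_left h2 (by positivity)

lemma choose_sq (M b : ℕ) : (M.choose b) ^ 2 * M ≤ 4 ^ M := by
  obtain ⟨m, rfl | rfl⟩ := Nat.even_or_odd' M
  · calc _ ≤ (Nat.centralBinom m) ^ 2 * (2 * m + 1) :=
          Nat.mul_le_mul (Nat.pow_le_pow_left (Nat.choose_le_centralBinom b m) 2) (by omega)
      _ ≤ 16 ^ m := centralBinom_sq m
      _ = _ := by rw [pow_mul]; norm_num
  · have h1 : (2 * m + 1).choose b ≤ (2 * m + 1).choose m := by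
      have := Nat.choose_le_middle b (2 * m + 1)
      rwa [show (2 * m + 1) / 2 = m by omega] at this
    have h2 : 2 * (2 * m + 1).choose m = Nat.centralBinom (m + 1) := by
      rw [Nat.centralBinom_eq_two_mul_choose, show 2 * (m + 1) = 2 * m + 1 + 1 by ring,
        Nat.choose_succ_succ, Nat.choose_symm_half]; ring
    have h3 := centralBinom_sq (m + 1)
    rw [← h2] at h3
    have h4 : ((2 * m + 1).choose b) ^ 2 * (2 * m + 1) ≤
      ((2 * m + 1).choose m) ^ 2 * (2 * (m + 1) + 1) :=
          Nat.mul_le_mul (Nat.pow_le_pow_left h1 2) (by omega)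
    have h5 : (16 : ℕ) ^ (m + 1) = 4 * 4 ^ (2 * m + 1) := by
      rw [pow_succ 4, pow_mul, pow_succ]; norm_num; ring
    rw [h5] at h3
    nlinarith

open Classical in
lemma subset_sum_count (M : ℕ) [Fact M.Prime] (b : ℕ) (t : ZMod M) :
    ((Finset.univ.powersetCard b).filter
      (fun A : Finset (ZMod M) => ∑ i ∈ A, i = t)).card ^ 2 * M ^ 3 ≤ 4 ^ M := by
  by_cases hb : (b : ZMod M) = 0
  · have hc : ((Finset.univ.powersetCard b).filter
      (fun A : Finset (ZMod M) => ∑ i ∈ A, i = t)).card ≤ 1 := by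
      refine (Finset.card_filter_le _ _).trans ?_
      rw [Finset.card_powersetCard, Finset.card_univ, ZMod.card]
      rw [ZMod.natCast_eq_zero_iff] at hb
      obtain ⟨j, rfl⟩ := hb
      rcases j with _ | _ | j
      · simp
      · simp
      · rw [Nat.choose_eq_zero_of_lt]; · omega
        have := (Fact.out : M.Prime).pos
        nlinarith
    have h4 : ∀ M : ℕ, M ^ 3 ≤ 4 ^ M := by
      intro M
      induction M with
      | zero => simp
      | succ k ih =>
        rcases Nat.lt_or_ge k 3 with h | h
        · interval_cases k <;> norm_num
        · rw [pow_succ 4]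
          have : (k + 1) ^ 3 ≤ k ^ 3 * 4 := by
            obtain ⟨j, rfl⟩ := Nat.exists_eq_add_of_le h
            ring_nf
            nlinarith [Nat.zero_le (j ^ 3), Nat.zero_le (j ^ 2)]
          omega
    calc _ ≤ 1 ^ 2 * M ^ 3 := by gcongr
      _ ≤ _ := by simpa using h4 M
  · set f : ZMod M → ℕ := fun t => ((Finset.univ.powersetCard b).filter
      (fun A : Finset (ZMod M) => ∑ i ∈ A, i = t)).card with hf
    have hle : ∀ t', f t ≤ f t' := by
      intro t'
      set c : ZMod M := (t' - t) / b
      apply Finset.card_le_card_of_injOn (fun A => A.map (addRightEmbedding c))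
      · intro A hA
        simp only [Finset.coe_filter, Finset.mem_powersetCard, Set.mem_ofPred_eq] at hA ⊢
        refine ⟨⟨Finset.subset_univ _, by rw [Finset.card_map]; exact hA.1.2⟩, ?_⟩
        rw [Finset.sum_map]
        simp only [addRightEmbedding_apply, Finset.sum_add_distrib, hA.2, Finset.sum_const,
          hA.1.2, nsmul_eq_mul]
        rw [mul_div_cancel₀ _ hb]; ring
      · intro A _ B _ h
        exact Finset.map_injective _ h
    have hsum : ∑ t', f t' = M.choose b := by
      rw [← Finset.card_eq_sum_card_fiberwise (f := fun A : Finset (ZMod M) => ∑ i ∈ A, i)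
        (fun _ _ => Finset.mem_coe.2 (Finset.mem_univ _)), Finset.card_powersetCard, Finset.card_univ, ZMod.card]
    have h1 : M * f t ≤ M.choose b := by
      rw [← hsum]
      have := Finset.card_nsmul_le_sum Finset.univ f (f t) (fun t' _ => hle t')
      rwa [Finset.card_univ, ZMod.card, smul_eq_mul] at this
    calc (f t) ^ 2 * M ^ 3 = (M * f t) ^ 2 * M := by ring
      _ ≤ (M.choose b) ^ 2 * M := by gcongr
      _ ≤ _ := choose_sq M b

open Classical in
lemma Q_count (M : ℕ) [Fact M.Prime] (hM : 2 < M) (s u : ℤ) :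
    (Finset.univ.filter (fun y : ZMod M → Bool => ∑ i, sg (y i) = s ∧
      ∑ i : ZMod M, sg (y i) * (i.val : ℤ) = u)).card ^ 2 * M ^ 3 ≤ 4 ^ M := by
  set Q := Finset.univ.filter (fun y : ZMod M → Bool => ∑ i, sg (y i) = s ∧
      ∑ i : ZMod M, sg (y i) * (i.val : ℤ) = u) with hQ
  rcases Q.eq_empty_or_nonempty with h0 | ⟨y0, hy0⟩
  · rw [h0]; simp
  set S : (ZMod M → Bool) → Finset (ZMod M) := fun y => Finset.univ.filter (fun i => y i = true)
    with hS
  have hsg : ∀ b : Bool, sg b = 2 * (if b = true then 1 else 0) - 1 := by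
    intro b; cases b <;> simp [sg]
  have hs : ∀ y, ∑ i, sg (y i) = 2 * ((S y).card : ℤ) - M := by
    intro y
    simp only [hsg, Finset.sum_sub_distrib, ← Finset.mul_sum, hS]
    simp
  have hu : ∀ y, ((∑ i : ZMod M, sg (y i) * (i.val : ℤ) : ℤ) : ZMod M)
      = 2 * (∑ i ∈ S y, i) - ∑ i : ZMod M, i := by
    intro y
    push_cast
    simp only [hsg, hS, ZMod.natCast_zmod_val]
    rw [Finset.sum_filter, Finset.mul_sum, ← Finset.sum_sub_distrib]
    apply Finset.sum_congr rfl
    intro i _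
    split_ifs <;> push_cast <;> ring
  have h2 : (2 : ZMod M) ≠ 0 := by
    intro h
    have : ((2 : ℕ) : ZMod M) = 0 := by exact_mod_cast h
    rw [ZMod.natCast_eq_zero_iff] at this
    exact absurd (Nat.le_of_dvd (by norm_num) this) (by omega)
  have key : Q.card ≤ ((Finset.univ.powersetCard (S y0).card).filter
      (fun A : Finset (ZMod M) => ∑ i ∈ A, i = ∑ i ∈ S y0, i)).card := by
    apply Finset.card_le_card_of_injOn S
    · intro y hy
      simp only [hQ, Finset.coe_filter, Finset.mem_filter, Finset.mem_univ, true_and, Set.mem_ofPred_eq] at hy hy0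
      simp only [Finset.coe_filter, Finset.mem_powersetCard, Set.mem_ofPred_eq]
      refine ⟨⟨Finset.subset_univ _, ?_⟩, ?_⟩
      · have h1 := hs y
        have h2 := hs y0
        rw [hy.1] at h1; rw [hy0.1] at h2
        omega
      · have h1 := hu y
        have h3 := hu y0
        rw [hy.2] at h1; rw [hy0.2] at h3
        rw [h1] at h3
        exact mul_left_cancel₀ h2 (sub_left_injective h3)
    · intro y _ y' _ h
      funext i
      have := congrArg (fun T => i ∈ T) h
      simp only [hS, Finset.mem_filter, Finset.mem_univ, true_and, eq_iff_iff] at this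
      exact Bool.eq_iff_iff.2 this
  calc _ ≤ _ := Nat.mul_le_mul_right _ (Nat.pow_le_pow_left key 2)
    _ ≤ _ := subset_sum_count M _ _

end LW

namespace LW

/-- the integer Littlewood polynomial -/
noncomputable def F (n : ℕ) (x : Fin (n + 1) → Bool) : Polynomial ℤ :=
  ∑ i : Fin (n + 1), Polynomial.C (sg (x i)) * Polynomial.X ^ (i : ℕ)

lemma aeval_F (n : ℕ) (x : Fin (n + 1) → Bool) (z : ℂ) :
    Polynomial.aeval z (F n x) = ∑ i, (sg (x i) : ℂ) * z ^ (i : ℕ) := by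
  simp [F, map_sum]

lemma aeval_dF (n : ℕ) (x : Fin (n + 1) → Bool) (z : ℂ) :
    z * Polynomial.aeval z (Polynomial.derivative (F n x))
      = ∑ i, (sg (x i) : ℂ) * (((i : ℕ) : ℂ) * z ^ (i : ℕ)) := by
  simp only [F, map_sum, Polynomial.derivative_C_mul_X_pow, map_mul, Polynomial.aeval_C, map_pow,
    Polynomial.aeval_X, Finset.mul_sum]
  apply Finset.sum_congr rfl
  intro i _
  rcases Nat.eq_zero_or_pos (i : ℕ) with h | h
  · simp [h]
  · have : z ^ (i : ℕ) = z * z ^ ((i : ℕ) - 1) := by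
      rw [← pow_succ', Nat.sub_add_cancel h]
    rw [this]; simp; ring

lemma real_indep (z : ℂ) (hz : z.im ≠ 0) (a b : ℤ) (h : (a : ℂ) + (b : ℂ) * z = 0) :
    a = 0 ∧ b = 0 := by
  have him := congrArg Complex.im h
  have hre := congrArg Complex.re h
  simp at him hre
  have hb : b = 0 := by
    rcases him with h | h
    · exact h
    · exact absurd h hz
  subst hb
  simp at hre
  exact ⟨hre, rfl⟩

open Classical in
lemma count_unity (n M k : ℕ) [Fact M.Prime] (hM : 2 < M) (hk : 2 ≤ k) (hkM : k * M ≤ n)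
    (z : ℂ) (hz : z.im ≠ 0) (hzk : z ^ k = 1) :
    (Finset.univ.filter (fun x : Fin (n + 1) → Bool => Polynomial.aeval z (F n x) = 0 ∧
      Polynomial.aeval z (Polynomial.derivative (F n x)) = 0)).card * M ^ 3 ≤ 2 ^ (n + 1) := by
  set E := Finset.univ.filter (fun x : Fin (n + 1) → Bool => Polynomial.aeval z (F n x) = 0 ∧
      Polynomial.aeval z (Polynomial.derivative (F n x)) = 0) with hE
  have hval : ∀ i : ZMod M, k * i.val + 1 ≤ n := by
    intro i
    have := ZMod.val_lt i
    have : k * (i.val + 1) ≤ k * M := Nat.mul_le_mul_left _ this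
    nlinarith
  let e : ZMod M ⊕ ZMod M → Fin (n + 1) := Sum.elim
    (fun i => ⟨k * i.val, by have := hval i; omega⟩)
    (fun i => ⟨k * i.val + 1, by have := hval i; omega⟩)
  have he : Function.Injective e := by
    have hmod : ∀ a b : ℕ, k * a ≠ k * b + 1 := by
      intro a b h
      have := congrArg (· % k) h
      simp [Nat.mod_eq_of_lt (show 1 < k by omega)] at this
    rintro (i | i) (j | j) h
    · simp [e] at h
      rcases h with h | h
      · rw [ZMod.val_injective M h]
      · omega
    · simp [e] at h; exact absurd h (hmod _ _)
    · simp [e] at h; exact absurd h.symm (hmod _ _)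
    · simp [e] at h
      rcases h with h | h
      · rw [ZMod.val_injective M h]
      · omega
  have hzp : ∀ j : ℕ, z ^ (k * j) = 1 := fun j => by rw [pow_mul, hzk, one_pow]
  have hc : ∀ ω : Fin (n + 1) → Bool,
      (Finset.univ.filter (fun x : ZMod M ⊕ ZMod M → Bool =>
        Function.extend e x ω ∈ E)).card ≤ 4 ^ M / M ^ 3 := by
    intro ω
    set X := Finset.univ.filter (fun x : ZMod M ⊕ ZMod M → Bool =>
        Function.extend e x ω ∈ E) with hX
    rw [Nat.le_div_iff_mul_le (by have := (Fact.out : M.Prime).pos; positivity)]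
    rcases X.eq_empty_or_nonempty with h0 | ⟨x0, hx0⟩
    · rw [h0]; simp
    let Q : (ZMod M → Bool) → Finset (ZMod M → Bool) := fun y0 =>
      Finset.univ.filter (fun y : ZMod M → Bool => ∑ i, sg (y i) = ∑ i, sg (y0 i) ∧
      ∑ i : ZMod M, sg (y i) * (i.val : ℤ) = ∑ i : ZMod M, sg (y0 i) * (i.val : ℤ))
    have hcard : X.card ≤ (Q (x0 ∘ Sum.inl) ×ˢ Q (x0 ∘ Sum.inr)).card := by
      apply Finset.card_le_card_of_injOn (fun x => (x ∘ Sum.inl, x ∘ Sum.inr))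
      · intro x hx
        have hx' : Function.extend e x ω ∈ E := by simpa [hX] using hx
        have hx0' : Function.extend e x0 ω ∈ E := by simpa [hX] using hx0
        simp only [hE, Finset.mem_filter, Finset.mem_univ, true_and] at hx' hx0'
        have d1 := extend_diff e he ω x x0 (fun i => z ^ (i : ℕ))
        have d2 := extend_diff e he ω x x0 (fun i => ((i : ℕ) : ℂ) * z ^ (i : ℕ))
        rw [← aeval_F, ← aeval_F, hx'.1, hx0'.1] at d1
        rw [← aeval_dF, ← aeval_dF, hx'.2, hx0'.2] at d2
        rw [Fintype.sum_sum_type] at d1 d2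
        simp only [e, Sum.elim_inl, Sum.elim_inr, pow_succ, hzp, one_mul, mul_one, mul_zero,
          sub_self] at d1 d2
        have r1 := real_indep z hz (∑ i, (sg (x (Sum.inl i)) - sg (x0 (Sum.inl i))))
          (∑ i, (sg (x (Sum.inr i)) - sg (x0 (Sum.inr i)))) (by
            rw [d1]; push_cast; rw [Finset.sum_mul])
        have r2 := real_indep z hz
          (∑ i : ZMod M, (sg (x (Sum.inl i)) - sg (x0 (Sum.inl i))) * ((k * i.val : ℕ) : ℤ))
          (∑ i : ZMod M, (sg (x (Sum.inr i)) - sg (x0 (Sum.inr i))) * ((k * i.val + 1 : ℕ) : ℤ)) (by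
            rw [d2]; push_cast; rw [Finset.sum_mul]
            congr 1
            apply Finset.sum_congr rfl; intro i _; ring)
        have r3 : (k : ℤ) * (∑ i : ZMod M, sg (x (Sum.inl i)) * (i.val : ℤ) -
            ∑ i : ZMod M, sg (x0 (Sum.inl i)) * (i.val : ℤ)) = 0 := by
          rw [← r2.1, ← Finset.sum_sub_distrib, Finset.mul_sum]
          apply Finset.sum_congr rfl; intro i _; push_cast; ring
        have r4 : (k : ℤ) * (∑ i : ZMod M, sg (x (Sum.inr i)) * (i.val : ℤ) -
            ∑ i : ZMod M, sg (x0 (Sum.inr i)) * (i.val : ℤ)) = 0 := by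
          have : (k : ℤ) * (∑ i : ZMod M, sg (x (Sum.inr i)) * (i.val : ℤ) -
            ∑ i : ZMod M, sg (x0 (Sum.inr i)) * (i.val : ℤ)) =
            ∑ i : ZMod M, (sg (x (Sum.inr i)) - sg (x0 (Sum.inr i))) * ((k * i.val + 1 : ℕ) : ℤ)
            - ∑ i, (sg (x (Sum.inr i)) - sg (x0 (Sum.inr i))) := by
            rw [← Finset.sum_sub_distrib, Finset.mul_sum, ← Finset.sum_sub_distrib]
            apply Finset.sum_congr rfl; intro i _; push_cast; ring
          rw [this, r2.2, r1.2, sub_zero]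
        have hk0 : (k : ℤ) ≠ 0 := by positivity
        have r5 := (mul_eq_zero.1 r3).resolve_left hk0
        have r6 := (mul_eq_zero.1 r4).resolve_left hk0
        have r7 := r1.1
        have r8 := r1.2
        rw [Finset.sum_sub_distrib] at r7 r8
        simp only [Finset.coe_product, Set.mem_prod, Finset.mem_coe, Q, Finset.mem_filter,
          Finset.mem_univ, true_and, Function.comp]
        refine ⟨⟨?_, ?_⟩, ?_, ?_⟩ <;> linarith
      · intro x _ y _ h
        simp only [Prod.mk.injEq] at h
        funext i
        rcases i with i | i
        · exact congrFun h.1 i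
        · exact congrFun h.2 i
    rw [Finset.card_product] at hcard
    have q1 : (Q (x0 ∘ Sum.inl)).card ^ 2 * M ^ 3 ≤ 4 ^ M := Q_count M hM _ _
    have q2 : (Q (x0 ∘ Sum.inr)).card ^ 2 * M ^ 3 ≤ 4 ^ M := Q_count M hM _ _
    set a := (Q (x0 ∘ Sum.inl)).card
    set b := (Q (x0 ∘ Sum.inr)).card
    have hab : 2 * (a * b) ≤ a ^ 2 + b ^ 2 := by
      have := two_mul_le_add_sq a b
      linarith
    have h1 : X.card * M ^ 3 ≤ a * b * M ^ 3 := Nat.mul_le_mul_right _ hcard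
    have h2 := Nat.mul_le_mul_right (M ^ 3) hab
    nlinarith
  have h := cond_count e he E (4 ^ M / M ^ 3) (fun ω => by convert hc ω)
  simp only [Fintype.card_sum, ZMod.card, Fintype.card_fin] at h
  have h4 : 4 ^ M / M ^ 3 * M ^ 3 ≤ 4 ^ M := Nat.div_mul_le_self _ _
  have h5 : (2 : ℕ) ^ (M + M) = 4 ^ M := by rw [← two_mul, pow_mul]; norm_num
  rw [h5] at h
  have h6 : (E.card * M ^ 3) * 4 ^ M ≤ 2 ^ (n + 1) * 4 ^ M := by
    calc (E.card * M ^ 3) * 4 ^ M = E.card * 4 ^ M * M ^ 3 := by ring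
      _ ≤ 4 ^ M / M ^ 3 * 2 ^ (n + 1) * M ^ 3 := Nat.mul_le_mul_right _ h
      _ = 4 ^ M / M ^ 3 * M ^ 3 * 2 ^ (n + 1) := by ring
      _ ≤ 4 ^ M * 2 ^ (n + 1) := Nat.mul_le_mul_right _ h4
      _ = _ := by ring
  exact Nat.le_of_mul_le_mul_right h6 (by positivity)

/-- polynomials with coefficients in the unit disc, leading coefficient of norm one, have no
roots of modulus at least two -/
lemma no_big_root (p : Polynomial ℂ) (hp : ‖p.leadingCoeff‖ = 1) (hc : ∀ i, ‖p.coeff i‖ ≤ 1)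
    (z : ℂ) (hz : 2 ≤ ‖z‖) : p.eval z ≠ 0 := by
  intro h
  rw [Polynomial.eval_eq_sum_range, Finset.sum_range_succ] at h
  have h1 : ‖p.coeff p.natDegree * z ^ p.natDegree‖
      = ‖∑ i ∈ Finset.range p.natDegree, p.coeff i * z ^ i‖ := by
    rw [← norm_neg, ← eq_neg_of_add_eq_zero_left h]
  rw [norm_mul, norm_pow, show ‖p.coeff p.natDegree‖ = 1 from hp, one_mul] at h1
  have h2 : ‖∑ i ∈ Finset.range p.natDegree, p.coeff i * z ^ i‖
      ≤ ∑ i ∈ Finset.range p.natDegree, ‖z‖ ^ i := by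
    refine (norm_sum_le _ _).trans (Finset.sum_le_sum fun i _ => ?_)
    rw [norm_mul, norm_pow]
    exact mul_le_of_le_one_left (by positivity) (hc i)
  have h3 := geom_sum_mul ‖z‖ p.natDegree
  have h4 : 0 ≤ ∑ i ∈ Finset.range p.natDegree, ‖z‖ ^ i := by positivity
  nlinarith

open Classical in
lemma count_big (n m K : ℕ) (hK : 0 < K) (hm : K * m ≤ n) (z : ℂ) (hz : 2 ≤ ‖z‖ ^ K) :
    (Finset.univ.filter (fun x : Fin (n + 1) → Bool => Polynomial.aeval z (F n x) = 0)).card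
      * 2 ^ m ≤ 2 ^ (n + 1) := by
  set E := Finset.univ.filter (fun x : Fin (n + 1) → Bool => Polynomial.aeval z (F n x) = 0)
    with hE
  let e : Fin m → Fin (n + 1) := fun i => ⟨K * i, by
    have := Nat.mul_le_mul_left K i.2.le
    omega⟩
  have he : Function.Injective e := by
    intro i j h
    simp only [e, Fin.mk.injEq] at h
    exact Fin.ext (Nat.eq_of_mul_eq_mul_left hK h)
  have h := cond_count e he E 1 (by
    intro ω
    rw [Finset.card_le_one]
    intro x hx y hy
    simp only [hE, Finset.mem_filter, Finset.mem_univ, true_and] at hx hy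
    have d1 := extend_diff e he ω x y (fun i => z ^ (i : ℕ))
    rw [← aeval_F, ← aeval_F, hx, hy, sub_self] at d1
    by_contra hne
    let p : Polynomial ℂ := ∑ i : Fin m,
      Polynomial.C (((sg (x i) : ℂ) - (sg (y i) : ℂ)) / 2) * Polynomial.X ^ (i : ℕ)
    have hcoef : ∀ j : Fin m, p.coeff j = ((sg (x j) : ℂ) - (sg (y j) : ℂ)) / 2 := by
      intro j
      simp only [p, Polynomial.finsetSum_coeff, Polynomial.coeff_C_mul_X_pow]
      rw [Finset.sum_eq_single j]
      · simp
      · intro b _ hb; rw [if_neg]; exact fun h => hb (Fin.ext h.symm)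
      · simp
    have hcoef' : ∀ j, m ≤ j → p.coeff j = 0 := by
      intro j hj
      simp only [p, Polynomial.finsetSum_coeff, Polynomial.coeff_C_mul_X_pow]
      apply Finset.sum_eq_zero
      intro i _
      rw [if_neg]; have := i.2; omega
    have hcases : ∀ a b : Bool, ((sg a : ℂ) - (sg b : ℂ)) / 2 ≠ 0 →
        ‖((sg a : ℂ) - (sg b : ℂ)) / 2‖ = 1 := by
      intro a b
      cases a <;> cases b <;> norm_num [sg]
    have hall : ∀ j, p.coeff j ≠ 0 → ‖p.coeff j‖ = 1 := by
      intro j hj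
      have hjm : j < m := by
        by_contra hh; exact hj (hcoef' j (by omega))
      have := hcoef ⟨j, hjm⟩
      simp only at this
      rw [this] at hj ⊢
      exact hcases _ _ hj
    have hp0 : p ≠ 0 := by
      intro h0
      apply hne
      funext j
      have := hcoef j
      rw [h0, Polynomial.coeff_zero] at this
      apply sg_inj
      have h2 : (sg (x j) : ℂ) = (sg (y j) : ℂ) := by
        rcases div_eq_zero_iff.1 this.symm with h | h
        · exact sub_eq_zero.1 h
        · norm_num at h
      exact_mod_cast h2
    refine no_big_root p (hall _ (Polynomial.leadingCoeff_ne_zero.2 hp0)) (fun i => ?_) (z ^ K)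
      (by rw [norm_pow]; exact hz) ?_
    · by_cases hi : p.coeff i = 0
      · rw [hi]; simp
      · rw [hall i hi]
    · simp only [p, Polynomial.eval_finsetSum, Polynomial.eval_mul, Polynomial.eval_C,
        Polynomial.eval_pow, Polynomial.eval_X]
      have : ∑ i : Fin m, ((sg (x i) : ℂ) - (sg (y i) : ℂ)) / 2 * (z ^ K) ^ (i : ℕ)
        = (∑ k, ((sg (x k) : ℂ) - (sg (y k) : ℂ)) * z ^ ((e k : Fin (n+1)) : ℕ)) / 2 := by
        rw [Finset.sum_div]
        apply Finset.sum_congr rfl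
        intro i _
        simp only [e, pow_mul]; ring
      rw [this, ← d1, zero_div])
  simpa using h

open Classical in
lemma count_mod3 (n d : ℕ) (hd : 2 * d ≤ n) (g : Polynomial (ZMod 3)) (hg : g.Monic)
    (hgd : g.natDegree = d) :
    (Finset.univ.filter (fun x : Fin (n + 1) → Bool =>
      g ^ 2 ∣ (F n x).map (Int.castRingHom (ZMod 3)))).card * 4 ^ d ≤ 2 ^ (n + 1) := by
  set E := Finset.univ.filter (fun x : Fin (n + 1) → Bool =>
      g ^ 2 ∣ (F n x).map (Int.castRingHom (ZMod 3))) with hE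
  let e : Fin (2 * d) → Fin (n + 1) := Fin.castLE (by omega)
  have he : Function.Injective e := Fin.castLE_injective _
  have hF : ∀ x, (F n x).map (Int.castRingHom (ZMod 3)) =
      ∑ i, ((sg (x i) : ℤ) : Polynomial (ZMod 3)) * Polynomial.X ^ (i : ℕ) := by
    intro x
    simp [F, Polynomial.map_sum]
  have h := cond_count e he E 1 (by
    intro ω
    rw [Finset.card_le_one]
    intro x hx y hy
    simp only [hE, Finset.mem_filter, Finset.mem_univ, true_and] at hx hy
    have d1 := extend_diff e he ω x y (fun i => (Polynomial.X : Polynomial (ZMod 3)) ^ (i : ℕ))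
    rw [← hF, ← hF] at d1
    have hdv := dvd_sub hx hy
    rw [d1] at hdv
    have hz : ∑ k : Fin (2 * d), (((sg (x k) : ℤ) : Polynomial (ZMod 3)) - ((sg (y k) : ℤ) : Polynomial (ZMod 3))) *
        Polynomial.X ^ ((e k : Fin (n + 1)) : ℕ) = 0 := by
      by_contra hne
      have h1 := Polynomial.degree_le_of_dvd hdv hne
      have h2 : (g ^ 2).degree = ((2 * d : ℕ) : WithBot ℕ) := by
        rw [Polynomial.degree_eq_natDegree (hg.pow 2).ne_zero, hg.natDegree_pow, hgd]
      rw [h2] at h1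
      have h3 : (∑ k : Fin (2 * d), (((sg (x k) : ℤ) : Polynomial (ZMod 3)) - ((sg (y k) : ℤ) : Polynomial (ZMod 3))) *
        Polynomial.X ^ ((e k : Fin (n + 1)) : ℕ)).degree < ((2 * d : ℕ) : WithBot ℕ) := by
        have := Polynomial.degree_sum_fin_lt (fun k : Fin (2 * d) => ((sg (x k) : ZMod 3) - (sg (y k) : ZMod 3)))
        convert this using 3 with k
        simp [e]
      exact absurd h1 (not_le.2 h3)
    funext j
    have hc := congrArg (fun p => p.coeff (j : ℕ)) hz
    have hc2 : (sg (x j) : ZMod 3) - (sg (y j) : ZMod 3) = 0 := by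
      rw [← Polynomial.coeff_zero (R := ZMod 3) (j : ℕ), ← hc]
      have hC : ∀ k, ((sg (x k) : ℤ) : Polynomial (ZMod 3)) - ((sg (y k) : ℤ) : Polynomial (ZMod 3))
          = Polynomial.C ((sg (x k) : ZMod 3) - (sg (y k) : ZMod 3)) := by intro k; simp
      simp only [Polynomial.finsetSum_coeff, hC]
      rw [Finset.sum_eq_single j]
      · rw [Polynomial.coeff_C_mul_X_pow]
        simp [e]
      · intro b _ hb
        rw [Polynomial.coeff_C_mul_X_pow, if_neg]
        intro h; exact hb (Fin.ext h.symm)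
      · simp
    revert hc2
    cases x j <;> cases y j <;> simp [sg] <;> decide)
  have h4 : (2 : ℕ) ^ (2 * d) = 4 ^ d := by rw [pow_mul]; norm_num
  simpa [h4] using h

end LW

namespace LW

lemma totient_bound (k : ℕ) : 0 < k → (Odd k → k ≤ k.totient ^ 2) ∧ k ≤ 2 * k.totient ^ 2 := by
  induction k using Nat.recOnPosPrimePosCoprime with
  | prime_pow p m hp hm =>
    intro _
    obtain ⟨m, rfl⟩ : ∃ j, m = j + 1 := ⟨m - 1, by omega⟩
    rw [Nat.totient_prime_pow_succ hp]
    rcases hp.eq_two_or_odd' with rfl | ho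
    · refine ⟨fun h => ?_, ?_⟩
      · exfalso
        have : Even (2 ^ (m + 1)) := by simp [Nat.even_pow]
        exact (Nat.not_even_iff_odd.2 h) this
      · have : 1 ≤ 2 ^ m := Nat.one_le_two_pow
        rw [pow_succ]; norm_num; nlinarith
    · have h3 : 3 ≤ p := by
        have := hp.two_le
        rcases ho with ⟨j, rfl⟩; omega
      have : p ^ (m + 1) ≤ (p ^ m * (p - 1)) ^ 2 := by
        obtain ⟨q, rfl⟩ : ∃ q, p = q + 3 := ⟨p - 3, by omega⟩
        have h1 : 1 ≤ (q + 3) ^ m := Nat.one_le_pow _ _ (by omega)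
        rw [pow_succ, mul_pow, show q + 3 - 1 = q + 2 by omega]
        apply Nat.mul_le_mul <;> nlinarith
      exact ⟨fun _ => this, by omega⟩
  | zero => intro h; omega
  | one => simp
  | coprime a b ha hb hab iha ihb =>
    intro _
    obtain ⟨a1, a2⟩ := iha (by omega)
    obtain ⟨b1, b2⟩ := ihb (by omega)
    rw [Nat.totient_mul hab]
    refine ⟨fun h => ?_, ?_⟩
    · obtain ⟨h1, h2⟩ := Nat.odd_mul.1 h
      rw [mul_pow]
      exact Nat.mul_le_mul (a1 h1) (b1 h2)
    · rw [mul_pow]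
      by_cases h : Odd a
      · have := Nat.mul_le_mul (a1 h) b2
        linarith
      · have hb' : Odd b := by
          by_contra h'
          rw [Nat.not_odd_iff_even] at h h'
          have := Nat.dvd_gcd h.two_dvd h'.two_dvd
          rw [hab] at this
          omega
        have := Nat.mul_le_mul a2 (b1 hb')
        linarith

/-- conjugates of `α` -/
noncomputable def Zr (α : ℂ) : Finset ℂ := ((minpoly ℤ α).aroots ℂ).toFinset

lemma mem_Zr {α : ℂ} (hα : IsIntegral ℤ α) (β : ℂ) :
    β ∈ Zr α ↔ Polynomial.aeval β (minpoly ℤ α) = 0 := by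
  rw [Zr, Multiset.mem_toFinset, Polynomial.mem_aroots]
  simp [minpoly.ne_zero hα]

lemma card_Zr (α : ℂ) : (Zr α).card ≤ (minpoly ℤ α).natDegree := by
  refine (Multiset.toFinset_card_le _).trans ((Polynomial.card_roots' _).trans ?_)
  exact Polynomial.natDegree_map_le

lemma psum_int {α : ℂ} (hα : IsIntegral ℤ α) (k : ℕ) : ∃ m : ℤ, ∑ β ∈ Zr α, β ^ k = (m : ℂ) := by
  have hQ : IsIntegral ℚ α := hα.tower_top
  have : FiniteDimensional ℚ (IntermediateField.adjoin ℚ {α}) :=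
    IntermediateField.adjoin.finiteDimensional hQ
  have hg : IsIntegral ℤ (IntermediateField.AdjoinSimple.gen ℚ α) := by
    rw [← isIntegral_algebraMap_iff (A := IntermediateField.adjoin ℚ {α}) (B := ℂ)
      (algebraMap (IntermediateField.adjoin ℚ ({α} : Set ℂ)) ℂ).injective, IntermediateField.AdjoinSimple.algebraMap_gen]
    exact hα
  have h1 := Algebra.isIntegral_trace (L := ℚ) (hg.pow k)
  obtain ⟨m, hm⟩ := IsIntegrallyClosed.isIntegral_iff.1 h1
  refine ⟨m, ?_⟩
  have h2 := trace_eq_sum_embeddings (K := ℚ) ℂ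
    (x := (IntermediateField.AdjoinSimple.gen ℚ α) ^ k)
  rw [← hm] at h2
  have h3 : ((m : ℤ) : ℂ) = (algebraMap ℚ ℂ) ((algebraMap ℤ ℚ) m) := by simp
  rw [h3, h2]
  have hmin : minpoly ℚ α = (minpoly ℤ α).map (algebraMap ℤ ℚ) :=
    minpoly.isIntegrallyClosed_eq_field_fractions' ℚ hα
  have hroots : (minpoly ℚ α).aroots ℂ = (minpoly ℤ α).aroots ℂ := by
    rw [hmin, Polynomial.aroots_def, Polynomial.aroots_def, Polynomial.map_map,
      ← IsScalarTower.algebraMap_eq]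
  symm
  apply Finset.sum_bij (fun (σ : IntermediateField.adjoin ℚ {α} →ₐ[ℚ] ℂ) _ =>
    σ (IntermediateField.AdjoinSimple.gen ℚ α))
  · intro σ _
    rw [mem_Zr hα]
    have := minpoly.aeval ℤ (IntermediateField.AdjoinSimple.gen ℚ α)
    have h5 : minpoly ℤ (IntermediateField.AdjoinSimple.gen ℚ α) = minpoly ℤ α := by
      rw [← minpoly.algebraMap_eq (B := IntermediateField.adjoin ℚ {α}) (B' := ℂ)
        (algebraMap (IntermediateField.adjoin ℚ ({α} : Set ℂ)) ℂ).injective, IntermediateField.AdjoinSimple.algebraMap_gen]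
    rw [h5] at this
    have h6 := Polynomial.aeval_algHom_apply (σ.restrictScalars ℤ)
      (IntermediateField.AdjoinSimple.gen ℚ α) (minpoly ℤ α)
    rw [this, map_zero] at h6
    exact h6
  · intro σ _ τ _ h
    exact IntermediateField.algHom_ext_of_eq_adjoin _ rfl (by
      intro x hx
      simp at hx
      subst hx
      exact h)
  · intro β hβ
    rw [Zr, Multiset.mem_toFinset, ← hroots] at hβ
    exact ⟨(IntermediateField.algHomAdjoinIntegralEquiv ℚ hQ).symm ⟨β, hβ⟩, Finset.mem_univ _,
      IntermediateField.algHomAdjoinIntegralEquiv_symm_apply_gen ℚ hQ _⟩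
  · intro σ _
    simp

lemma sum_pow_prime {R ι : Type*} [CommRing R] (p : ℕ) (hp : p.Prime) (s : Finset ι) (f : ι → R) :
    ∃ r, (∑ i ∈ s, f i) ^ p = ∑ i ∈ s, f i ^ p + p * r := by
  classical
  induction s using Finset.induction_on with
  | empty => exact ⟨0, by simp [hp.ne_zero]⟩
  | insert a s ha ih =>
    obtain ⟨r, hr⟩ := ih
    rw [Finset.sum_insert ha, Finset.sum_insert ha]
    obtain ⟨t, ht⟩ := exists_add_pow_prime_eq hp (f a) (∑ i ∈ s, f i)
    refine ⟨r + f a * (∑ i ∈ s, f i) * t, ?_⟩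
    rw [ht, hr]; ring

lemma psum_congr {α : ℂ} (hα : IsIntegral ℤ α) (p : ℕ) (hp : p.Prime) (k : ℕ) (a b : ℤ)
    (ha : ∑ β ∈ Zr α, β ^ k = (a : ℂ)) (hb : ∑ β ∈ Zr α, β ^ (k * p) = (b : ℂ)) :
    (p : ℤ) ∣ a - b := by
  have hint : ∀ β ∈ Zr α, IsIntegral ℤ β := by
    intro β hβ
    exact ⟨minpoly ℤ α, minpoly.monic hα, (mem_Zr hα β).1 hβ⟩
  obtain ⟨r, hr⟩ := sum_pow_prime (R := integralClosure ℤ ℂ) p hp (Finset.univ : Finset (Zr α))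
    (fun β => ⟨β.1 ^ k, (hint β.1 β.2).pow k⟩)
  have hr2 := congrArg (algebraMap (integralClosure ℤ ℂ) ℂ) hr
  simp only [map_pow, map_sum, map_add, map_mul, map_natCast] at hr2
  have e1 : ∀ j : ℕ, ∑ β : Zr α, (β.1) ^ j = ∑ β ∈ Zr α, β ^ j := fun j =>
    Finset.sum_coe_sort (Zr α) (fun β => β ^ j)
  have e2 : ∀ β : Zr α, (algebraMap (integralClosure ℤ ℂ) ℂ) ⟨β.1 ^ k, (hint β.1 β.2).pow k⟩
    = β.1 ^ k := fun β => rfl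
  simp only [e2, ← pow_mul, e1, ha, hb] at hr2
  have hrint : IsIntegral ℤ (algebraMap (integralClosure ℤ ℂ) ℂ r) := r.2
  have hp0 : (p : ℂ) ≠ 0 := by exact_mod_cast hp.ne_zero
  have hrq : algebraMap (integralClosure ℤ ℂ) ℂ r = algebraMap ℚ ℂ (((a ^ p - b : ℤ) : ℚ) / p) := by
    rw [map_div₀]
    simp only [map_intCast, map_natCast]
    rw [eq_div_iff hp0]
    push_cast
    linear_combination -hr2
  rw [hrq, isIntegral_algebraMap_iff (algebraMap ℚ ℂ).injective] at hrint
  obtain ⟨m, hm⟩ := IsIntegrallyClosed.isIntegral_iff.1 hrint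
  have hp0' : (p : ℚ) ≠ 0 := by exact_mod_cast hp.ne_zero
  have hm2 : a ^ p - b = m * p := by
    have : ((a ^ p - b : ℤ) : ℚ) = m * p := by
      rw [eq_div_iff hp0'] at hm
      rw [← hm]; simp
    exact_mod_cast this
  have : Fact p.Prime := ⟨hp⟩
  have hfer : (p : ℤ) ∣ a ^ p - a := by
    rw [← ZMod.intCast_zmod_eq_zero_iff_dvd]
    push_cast
    rw [ZMod.pow_card, sub_self]
  have : a - b = m * p - (a ^ p - a) := by rw [← hm2]; ring
  rw [this]
  exact dvd_sub (Dvd.intro_left _ rfl) hfer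

lemma house {α : ℂ} (hα : IsIntegral ℤ α) (h0 : α ≠ 0) (D : ℕ) (hD : 1 ≤ D)
    (hd : (minpoly ℤ α).natDegree ≤ D) (hh : ∀ β ∈ Zr α, ‖β‖ ^ (32 * D ^ 2) ≤ 2) :
    ∃ m, 0 < m ∧ α ^ m = 1 := by
  classical
  obtain ⟨p, hp, hp1, hp2⟩ := Nat.exists_prime_lt_and_le_two_mul (8 * D) (by omega)
  have hbound : ∀ j ≤ 32 * D ^ 2, ‖∑ β ∈ Zr α, β ^ j‖ ≤ 2 * D := by
    intro j hj
    have h1 : ∀ β ∈ Zr α, ‖β ^ j‖ ≤ 2 := by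
      intro β hβ
      rw [norm_pow]
      rcases le_total ‖β‖ 1 with h | h
      · exact (pow_le_one₀ (norm_nonneg _) h).trans (by norm_num)
      · exact (pow_le_pow_right₀ h hj).trans (hh β hβ)
    refine (norm_sum_le_of_le _ h1).trans ?_
    rw [Finset.sum_const, nsmul_eq_mul, mul_comm]
    have : ((Zr α).card : ℝ) ≤ D := by exact_mod_cast (card_Zr α).trans hd
    linarith
  have heq : ∀ k ≤ 2 * D, ∑ β ∈ Zr α, β ^ k = ∑ β ∈ Zr α, β ^ (k * p) := by
    intro k hk
    obtain ⟨a, ha⟩ := psum_int hα k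
    obtain ⟨b, hb⟩ := psum_int hα (k * p)
    have hdvd := psum_congr hα p hp k a b ha hb
    have hkp : k * p ≤ 32 * D ^ 2 := by
      calc k * p ≤ (2 * D) * (2 * (8 * D)) := Nat.mul_le_mul hk hp2
        _ = _ := by ring
    have hk2 : k ≤ 32 * D ^ 2 := by nlinarith
    have h1 := hbound k hk2
    have h2 := hbound (k * p) hkp
    rw [ha, Complex.norm_intCast] at h1
    rw [hb, Complex.norm_intCast] at h2
    have h1' : |a| ≤ 2 * D := by exact_mod_cast h1
    have h2' : |b| ≤ 2 * D := by exact_mod_cast h2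
    have h3 : |a - b| < p := by
      have := abs_sub a b
      have hp1' : (8 * D : ℤ) < p := by exact_mod_cast hp1
      have := abs_le.1 h1'
      have := abs_le.1 h2'
      rw [abs_lt]; constructor <;> linarith
    have h4 : a - b = 0 := Int.eq_zero_of_abs_lt_dvd hdvd h3
    rw [ha, hb, sub_eq_zero.1 h4]
  have hsurj : ∀ γ ∈ Zr α, ∃ β ∈ Zr α, β ^ p = γ := by
    intro γ hγ
    by_contra hno
    push Not at hno
    set W := ((Zr α) ∪ (Zr α).image (fun β => β ^ p)).erase γ with hW
    set P : Polynomial ℂ := ∏ w ∈ W, (Polynomial.X - Polynomial.C w) with hP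
    have hdeg : P.natDegree ≤ 2 * D := by
      rw [hP, Polynomial.natDegree_prod_of_monic _ _ (fun w _ => Polynomial.monic_X_sub_C w)]
      simp only [Polynomial.natDegree_X_sub_C, Finset.sum_const, smul_eq_mul, mul_one]
      refine (Finset.card_erase_le).trans ((Finset.card_union_le _ _).trans ?_)
      have h1 := (card_Zr α).trans hd
      have h2 : ((Zr α).image (fun β => β ^ p)).card ≤ (Zr α).card := Finset.card_image_le
      omega
    have hev : ∀ z, P.eval z = ∑ k ∈ Finset.range (2 * D + 1), P.coeff k * z ^ k := fun z =>
      Polynomial.eval_eq_sum_range' (by omega) z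
    have hroot : ∀ w ∈ W, P.eval w = 0 := by
      intro w hw
      rw [hP, Polynomial.eval_prod]
      exact Finset.prod_eq_zero hw (by simp)
    have hγne : P.eval γ ≠ 0 := by
      rw [hP, Polynomial.eval_prod, Finset.prod_ne_zero_iff]
      intro w hw
      simp only [Polynomial.eval_sub, Polynomial.eval_X, Polynomial.eval_C]
      exact sub_ne_zero.2 (Finset.ne_of_mem_erase hw).symm
    have s1 : ∑ β ∈ Zr α, P.eval β = P.eval γ := by
      apply Finset.sum_eq_single_of_mem γ hγ
      intro β hβ hne
      exact hroot β (Finset.mem_erase.2 ⟨hne, Finset.mem_union_left _ hβ⟩)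
    have s2 : ∑ β ∈ Zr α, P.eval (β ^ p) = 0 := by
      apply Finset.sum_eq_zero
      intro β hβ
      exact hroot _ (Finset.mem_erase.2 ⟨hno β hβ, Finset.mem_union_right _
        (Finset.mem_image_of_mem _ hβ)⟩)
    apply hγne
    rw [← s1, ← s2]
    simp only [hev]
    rw [Finset.sum_comm, Finset.sum_comm (s := Zr α)]
    apply Finset.sum_congr rfl
    intro k hk
    rw [← Finset.mul_sum, ← Finset.mul_sum, heq k (by simp at hk; omega)]
    simp only [← pow_mul, mul_comm]
  have himg : (Zr α).image (fun β => β ^ p) = Zr α := by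
    symm
    apply Finset.eq_of_subset_of_card_le
    · intro γ hγ
      obtain ⟨β, hβ, h⟩ := hsurj γ hγ
      exact Finset.mem_image.2 ⟨β, hβ, h⟩
    · exact Finset.card_image_le
  have hiter : ∀ j : ℕ, α ^ (p ^ j) ∈ Zr α := by
    intro j
    induction j with
    | zero => rw [mem_Zr hα]; simp
    | succ j ih =>
      rw [pow_succ, pow_mul, ← himg]
      exact Finset.mem_image_of_mem _ ih
  obtain ⟨i, j, hij, hfeq⟩ := Finite.exists_ne_map_eq_of_infinite
    (fun j : ℕ => (⟨α ^ (p ^ j), hiter j⟩ : Zr α))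
  have hfeq' : α ^ (p ^ i) = α ^ (p ^ j) := congrArg Subtype.val hfeq
  have key : ∀ a b : ℕ, a < b → α ^ a = α ^ b → ∃ m, 0 < m ∧ α ^ m = 1 := by
    intro a b hab h
    refine ⟨b - a, by omega, ?_⟩
    have h2 : α ^ a * α ^ (b - a) = α ^ a * 1 := by
      rw [← pow_add, Nat.add_sub_cancel' hab.le, mul_one, h]
    exact mul_left_cancel₀ (pow_ne_zero _ h0) h2
  have hne : p ^ i ≠ p ^ j := fun h => hij (Nat.pow_right_injective hp.two_le h)
  rcases lt_or_gt_of_ne hne with h | h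
  · exact key _ _ h hfeq'
  · exact key _ _ h hfeq'.symm

end LW

namespace LW

lemma coeff_F (n : ℕ) (x : Fin (n + 1) → Bool) (i : Fin (n + 1)) : (F n x).coeff i = sg (x i) := by
  simp only [F, Polynomial.finsetSum_coeff, Polynomial.coeff_C_mul_X_pow]
  rw [Finset.sum_eq_single i]
  · simp
  · intro b _ hb; rw [if_neg]; exact fun h => hb (Fin.ext h.symm)
  · simp

lemma coeff_F' (n : ℕ) (x : Fin (n + 1) → Bool) (i : ℕ) (hi : n < i) : (F n x).coeff i = 0 := by
  simp only [F, Polynomial.finsetSum_coeff, Polynomial.coeff_C_mul_X_pow]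
  apply Finset.sum_eq_zero
  intro j _
  rw [if_neg]; have := j.2; omega

lemma sg_ne (b : Bool) : sg b ≠ 0 := by cases b <;> simp [sg]

lemma sg_sq (b : Bool) : sg b * sg b = 1 := by cases b <;> simp [sg]

lemma natDegree_F (n : ℕ) (x : Fin (n + 1) → Bool) : (F n x).natDegree = n := by
  apply le_antisymm
  · rw [Polynomial.natDegree_le_iff_coeff_eq_zero]
    intro i hi; exact coeff_F' n x i hi
  · apply Polynomial.le_natDegree_of_ne_zero
    have := coeff_F n x (Fin.last n)
    rw [Fin.val_last] at this
    rw [this]; exact sg_ne _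

lemma leadingCoeff_F (n : ℕ) (x : Fin (n + 1) → Bool) :
    (F n x).leadingCoeff = sg (x (Fin.last n)) := by
  rw [Polynomial.leadingCoeff, natDegree_F]
  exact coeff_F n x (Fin.last n)

lemma F_ne (n : ℕ) (x : Fin (n + 1) → Bool) : F n x ≠ 0 := by
  rw [← Polynomial.leadingCoeff_ne_zero, leadingCoeff_F]; exact sg_ne _

lemma root_lt_two (n : ℕ) (x : Fin (n + 1) → Bool) (z : ℂ) (h : Polynomial.aeval z (F n x) = 0) :
    ‖z‖ < 2 := by
  by_contra hz
  push Not at hz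
  have hs : ∀ b : Bool, ‖((sg b : ℤ) : ℂ)‖ = 1 := by intro b; cases b <;> simp [sg]
  have hinj : Function.Injective (Int.castRingHom ℂ) := Int.cast_injective
  refine no_big_root ((F n x).map (Int.castRingHom ℂ)) ?_ ?_ z hz ?_
  · rw [Polynomial.leadingCoeff_map_of_injective hinj, leadingCoeff_F]
    exact hs _
  · intro i
    rw [Polynomial.coeff_map]
    rcases Nat.lt_or_ge n i with hi | hi
    · rw [coeff_F' n x i hi]; simp
    · have := coeff_F n x ⟨i, by omega⟩
      simp only at this
      rw [this]
      exact (hs _).le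
  · rw [Polynomial.eval_map]
    exact h

lemma root_integral (n : ℕ) (x : Fin (n + 1) → Bool) (z : ℂ)
    (h : Polynomial.aeval z (F n x) = 0) : IsIntegral ℤ z := by
  refine ⟨Polynomial.C (sg (x (Fin.last n))) * F n x, ?_, ?_⟩
  · rw [Polynomial.Monic, Polynomial.leadingCoeff_mul, Polynomial.leadingCoeff_C, leadingCoeff_F]
    exact sg_sq _
  · rw [← Polynomial.aeval_def, map_mul, h, mul_zero]

lemma root_ne (n : ℕ) (x : Fin (n + 1) → Bool) (z : ℂ)
    (h : Polynomial.aeval z (F n x) = 0) : z ≠ 0 := by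
  rintro rfl
  rw [← Polynomial.coeff_zero_eq_aeval_zero'] at h
  have := coeff_F n x 0
  simp only [Fin.val_zero] at this
  rw [this] at h
  have h2 := sg_ne (x 0)
  simp at h
  exact h2 h

lemma parity (n : ℕ) (y : Fin (n + 1) → Bool) (h1 : ∑ i, sg (y i) = 0)
    (h2 : ∑ i : Fin (n + 1), sg (y i) * ((i : ℕ) : ℤ) = 0) : 4 ∣ n + 1 := by
  have hsg : ∀ b : Bool, sg b = 2 * (if b = true then 1 else 0) - 1 := by
    intro b; cases b <;> simp [sg]
  set B : ℤ := ∑ i, (if y i = true then 1 else 0) with hB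
  set C : ℤ := ∑ i : Fin (n + 1), (if y i = true then 1 else 0) * ((i : ℕ) : ℤ) with hC
  have e1 : 2 * B - (n + 1) = 0 := by
    rw [← h1]
    simp only [hsg, Finset.sum_sub_distrib, ← Finset.mul_sum, ← hB]
    simp
  have e2 : 2 * C - ∑ i : Fin (n + 1), ((i : ℕ) : ℤ) = 0 := by
    rw [← h2, hC, Finset.mul_sum, ← Finset.sum_sub_distrib]
    apply Finset.sum_congr rfl
    intro i _
    rw [hsg]; ring
  have e3 : (∑ i : Fin (n + 1), ((i : ℕ) : ℤ)) * 2 = (n + 1) * n := by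
    have := Finset.sum_range_id_mul_two (n + 1)
    rw [Fin.sum_univ_eq_sum_range (fun i => (i : ℤ)) (n + 1)]
    have h : ((∑ i ∈ Finset.range (n + 1), i : ℕ) : ℤ) * 2 = (n + 1) * n := by
      exact_mod_cast this
    push_cast at h
    exact h
  have e4 : B = 2 * (B ^ 2 - C) := by
    have hn : (n : ℤ) = 2 * B - 1 := by linarith
    rw [hn] at e3
    nlinarith
  have : (4 : ℤ) ∣ (n + 1 : ℤ) := ⟨B ^ 2 - C, by linarith⟩
  exact_mod_cast this

lemma real_case (n : ℕ) (x : Fin (n + 1) → Bool) (z : ℂ) (hz : z = 1 ∨ z = -1)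
    (h : Polynomial.aeval z (F n x) = 0)
    (h' : Polynomial.aeval z (Polynomial.derivative (F n x)) = 0) : 4 ∣ n + 1 := by
  have a1 := aeval_F n x z
  have a2 := aeval_dF n x z
  rw [h] at a1
  rw [h', mul_zero] at a2
  rcases hz with rfl | rfl
  · simp only [one_pow, mul_one] at a1 a2
    exact parity n x (by exact_mod_cast a1.symm) (by exact_mod_cast a2.symm)
  · have hs : ∀ i : Fin (n + 1), (sg (x i ^^ decide (Odd (i : ℕ))) : ℂ)
        = (sg (x i) : ℂ) * (-1) ^ (i : ℕ) := by
      intro i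
      by_cases hi : Odd (i : ℕ)
      · rw [hi.neg_one_pow]
        cases x i <;> simp [sg, hi]
      · rw [(Nat.not_odd_iff_even.1 hi).neg_one_pow]
        cases x i <;> simp [sg, hi]
    refine parity n (fun i => x i ^^ decide (Odd (i : ℕ))) ?_ ?_
    · have : ((∑ i : Fin (n + 1), sg (x i ^^ decide (Odd (i : ℕ))) : ℤ) : ℂ) = 0 := by
        push_cast
        rw [a1]
        exact Finset.sum_congr rfl fun i _ => hs i
      exact_mod_cast this
    · have : ((∑ i : Fin (n + 1), sg (x i ^^ decide (Odd (i : ℕ))) * ((i : ℕ) : ℤ) : ℤ) : ℂ) = 0 := by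
        push_cast
        rw [a2]
        refine Finset.sum_congr rfl fun i _ => ?_
        rw [hs i]; ring
      exact_mod_cast this

lemma minpoly_sq_dvd (f : Polynomial ℤ) (z : ℂ) (hz : IsIntegral ℤ z)
    (h : Polynomial.aeval z f = 0) (h' : Polynomial.aeval z (Polynomial.derivative f) = 0) :
    (minpoly ℤ z) ^ 2 ∣ f := by
  obtain ⟨q, hq⟩ := minpoly.isIntegrallyClosed_dvd hz h
  have hne : Polynomial.aeval z (Polynomial.derivative (minpoly ℤ z)) ≠ 0 := by
    intro h0
    have hdvd := minpoly.isIntegrallyClosed_dvd hz h0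
    have hpos := minpoly.natDegree_pos hz
    refine Polynomial.not_dvd_of_natDegree_lt ?_ ?_ hdvd
    · intro h1
      have := Polynomial.derivative_eq_zero.1 h1
      omega
    · exact Polynomial.natDegree_derivative_lt (by omega)
  rw [hq, Polynomial.derivative_mul, map_add, map_mul, map_mul, minpoly.aeval, zero_mul,
    add_zero] at h'
  have hq0 := (mul_eq_zero.1 h').resolve_left hne
  obtain ⟨r, hr⟩ := minpoly.isIntegrallyClosed_dvd hz hq0
  exact ⟨r, by rw [hq, hr]; ring⟩

lemma classify (n D : ℕ) (hD : 1 ≤ D) (hn : ¬ 4 ∣ n + 1) (x : Fin (n + 1) → Bool) (z : ℂ)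
    (h : Polynomial.aeval z (F n x) = 0)
    (h' : Polynomial.aeval z (Polynomial.derivative (F n x)) = 0) :
    (∃ d, D < d ∧ 2 * d ≤ n ∧ ∃ g : Polynomial (ZMod 3), g.Monic ∧ g.natDegree = d ∧
      g ^ 2 ∣ (F n x).map (Int.castRingHom (ZMod 3))) ∨
    (∃ k, 2 ≤ k ∧ k ≤ 2 * D ^ 2 ∧ z ^ k = 1 ∧ z.im ≠ 0) ∨
    (∃ g : Polynomial ℤ, g.natDegree ≤ D ∧ (∀ i, |g.coeff i| ≤ 4 ^ D) ∧ g ∣ F n x ∧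
      ∃ β : ℂ, Polynomial.aeval β g = 0 ∧ 2 ≤ ‖β‖ ^ (32 * D ^ 2)) := by
  have hz := root_integral n x z h
  have hz0 := root_ne n x z h
  have hsq := minpoly_sq_dvd _ z hz h h'
  have hdvd : minpoly ℤ z ∣ F n x := (dvd_pow_self _ two_ne_zero).trans hsq
  have hmon := minpoly.monic hz
  rcases Nat.lt_or_ge D (minpoly ℤ z).natDegree with hd | hd
  · left
    refine ⟨(minpoly ℤ z).natDegree, hd, ?_, (minpoly ℤ z).map (Int.castRingHom (ZMod 3)),
      hmon.map _, hmon.natDegree_map _, ?_⟩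
    · have := Polynomial.natDegree_le_of_dvd hsq (F_ne n x)
      rwa [hmon.natDegree_pow, natDegree_F] at this
    · rw [← Polynomial.map_pow]
      exact Polynomial.map_dvd _ hsq
  · right
    by_cases hb : ∃ β ∈ Zr z, 2 ≤ ‖β‖ ^ (32 * D ^ 2)
    · right
      obtain ⟨β, hβ, hβ2⟩ := hb
      refine ⟨minpoly ℤ z, hd, ?_, hdvd, β, (mem_Zr hz β).1 hβ, hβ2⟩
      intro i
      have hroots : ∀ w ∈ ((minpoly ℤ z).map (Int.castRingHom ℂ)).roots, ‖w‖ ≤ 2 := by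
        intro w hw
        have hw2 : Polynomial.aeval w (minpoly ℤ z) = 0 := by
          have := Polynomial.isRoot_of_mem_roots hw
          rw [Polynomial.IsRoot, Polynomial.eval_map] at this
          exact this
        refine (root_lt_two n x w ?_).le
        obtain ⟨q, hq⟩ := hdvd
        rw [hq, map_mul, hw2, zero_mul]
      have hc := Polynomial.coeff_bdd_of_roots_le (Int.castRingHom ℂ) hmon
        (IsAlgClosed.splits _) hd hroots i
      rw [Polynomial.coeff_map] at hc
      have h1 : ‖(Int.castRingHom ℂ) ((minpoly ℤ z).coeff i)‖ = |((minpoly ℤ z).coeff i : ℝ)| :=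
        Complex.norm_intCast _
      rw [h1, show max (2 : ℝ) 1 = 2 by norm_num] at hc
      have h2 : ((D.choose (D / 2) : ℕ) : ℝ) ≤ 2 ^ D := by
        exact_mod_cast Nat.choose_le_two_pow D (D / 2)
      have h3 : |((minpoly ℤ z).coeff i : ℝ)| ≤ 4 ^ D := by
        calc _ ≤ _ := hc
          _ ≤ (2 : ℝ) ^ D * 2 ^ D := by gcongr
          _ = 4 ^ D := by rw [← mul_pow]; norm_num
      exact_mod_cast h3
    · left
      push Not at hb
      obtain ⟨m, hm, hzm⟩ := house hz hz0 D hD hd (fun β hβ => (hb β hβ).le)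
      have him : z.im ≠ 0 := by
        intro him
        apply hn
        apply real_case n x z _ h h'
        have hnorm : ‖z‖ = 1 := Complex.norm_eq_one_of_pow_eq_one hzm hm.ne'
        have hre : z = (z.re : ℂ) := by apply Complex.ext <;> simp [him]
        rw [hre, Complex.norm_real, Real.norm_eq_abs] at hnorm
        rcases eq_or_eq_neg_of_abs_eq hnorm with h | h
        · left; rw [hre, h]; simp
        · right; rw [hre, h]; simp
      have hfin : IsOfFinOrder z := isOfFinOrder_iff_pow_eq_one.2 ⟨m, hm, hzm⟩
      have hpos := hfin.orderOf_pos
      have hprim := IsPrimitiveRoot.orderOf z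
      refine ⟨orderOf z, ?_, ?_, pow_orderOf_eq_one z, him⟩
      · by_contra hlt
        have : orderOf z = 1 := by omega
        rw [orderOf_eq_one_iff] at this
        rw [this] at him; simp at him
      · have h1 := (totient_bound _ hpos).2
        have h2 := hprim.totient_le_degree_minpoly.trans hd
        have h3 := Nat.pow_le_pow_left h2 2
        omega

end LW

namespace LW

open Classical in
/-- sign patterns with a double root -/
noncomputable def Bad (n : ℕ) : Finset (Fin (n + 1) → Bool) :=
  Finset.univ.filter (fun x => ∃ z : ℂ, Polynomial.aeval z (F n x) = 0 ∧
    Polynomial.aeval z (Polynomial.derivative (F n x)) = 0)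

lemma count_eq (n : ℕ) : littlewoodDoubleRootCount n ≤ (Bad n).card := by
  classical
  have hpoly : ∀ x : Fin (n + 1) → Bool,
      polyOf n (fun i => sg (x i)) = (F n x).map (Int.castRingHom ℂ) := by
    intro x
    simp [polyOf, F, Polynomial.map_sum]
  let φ : {a : Fin (n + 1) → ℤ // (∀ j, a j = 1 ∨ a j = -1) ∧ hasDoubleRoot n a} → Bad n :=
    fun a => ⟨fun i => decide (a.1 i = 1), by
      have ha : a.1 = fun i => sg (decide (a.1 i = 1)) := by
        funext i
        rcases a.2.1 i with h | h <;> simp [h, sg]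
      obtain ⟨z, h1, h2⟩ := a.2.2
      rw [ha, hpoly] at h1 h2
      simp only [Bad, Finset.mem_filter, Finset.mem_univ, true_and]
      refine ⟨z, ?_, ?_⟩
      · rw [Polynomial.eval_map] at h1
        exact h1
      · rw [Polynomial.derivative_map, Polynomial.eval_map] at h2
        exact h2⟩
  have hφ : Function.Injective φ := by
    intro a b hab
    apply Subtype.ext
    funext i
    have h := congrFun (congrArg Subtype.val hab) i
    simp only [φ, decide_eq_decide] at h
    rcases a.2.1 i with h1 | h1 <;> rcases b.2.1 i with h2 | h2 <;> simp_all
  have := Nat.card_le_card_of_injective φ hφ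
  rw [littlewoodDoubleRootCount]
  simpa using this

lemma biUnion_real {α β : Type*} [DecidableEq β] (s : Finset α) (t : α → Finset β) (c : ℝ)
    (h : ∀ a ∈ s, ((t a).card : ℝ) ≤ c) : ((s.biUnion t).card : ℝ) ≤ s.card * c := by
  calc ((s.biUnion t).card : ℝ) ≤ ((∑ a ∈ s, (t a).card : ℕ) : ℝ) := by
        exact_mod_cast Finset.card_biUnion_le
    _ = ∑ a ∈ s, ((t a).card : ℝ) := by push_cast; rfl
    _ ≤ s.card • c := Finset.sum_le_card_nsmul _ _ _ h
    _ = _ := by simp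

open Classical in
/-- monic polynomials of degree `d` over `ZMod 3` -/
noncomputable def G3 (d : ℕ) : Finset (Polynomial (ZMod 3)) :=
  ((Finset.univ : Finset (Fin d → ZMod 3)).image (fun c => Polynomial.X ^ d +
    ∑ i : Fin d, Polynomial.C (c i) * Polynomial.X ^ (i : ℕ))).filter
    (fun g => g.Monic ∧ g.natDegree = d)

lemma card_G3 (d : ℕ) : (G3 d).card ≤ 3 ^ d := by
  refine (Finset.card_filter_le _ _).trans (Finset.card_image_le.trans ?_)
  simp [ZMod.card]

lemma mem_G3 (g : Polynomial (ZMod 3)) (hg : g.Monic) : g ∈ G3 g.natDegree := by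
  simp only [G3, Finset.mem_filter, Finset.mem_image, Finset.mem_univ, true_and]
  refine ⟨⟨fun i => g.coeff i, ?_⟩, hg, by trivial⟩
  conv_rhs => rw [hg.as_sum]
  rw [Fin.sum_univ_eq_sum_range (fun i => Polynomial.C (g.coeff i) * Polynomial.X ^ i)]

/-- `g` has a root of large absolute value -/
def BigRoot (D : ℕ) (g : Polynomial ℤ) : Prop :=
  ∃ β : ℂ, Polynomial.aeval β g = 0 ∧ 2 ≤ ‖β‖ ^ (32 * D ^ 2)

open Classical in
/-- integer polynomials of degree at most `D` with bounded coefficients and a big root -/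
noncomputable def GZ (D : ℕ) : Finset (Polynomial ℤ) :=
  ((Fintype.piFinset (fun _ : Fin (D + 1) => Finset.Icc (-4 ^ D : ℤ) (4 ^ D))).image
    (fun c => ∑ i : Fin (D + 1), Polynomial.C (c i) * Polynomial.X ^ (i : ℕ))).filter
    (fun g : Polynomial ℤ => BigRoot D g)

open Classical in
lemma card_GZ (D : ℕ) : (GZ D).card ≤ 2 ^ (2 * (D + 1) ^ 2) := by
  refine (Finset.card_filter_le _ _).trans (Finset.card_image_le.trans ?_)
  rw [Fintype.card_piFinset]
  simp only [Int.card_Icc, Finset.prod_const, Finset.card_univ, Fintype.card_fin]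
  have h1 : ((4 : ℤ) ^ D + 1 - -4 ^ D).toNat ≤ 4 ^ (D + 1) := by
    have : (1 : ℤ) ≤ 4 ^ D := one_le_pow₀ (by norm_num)
    rw [Int.toNat_le]
    push_cast
    rw [pow_succ]
    linarith
  calc _ ≤ (4 ^ (D + 1)) ^ (D + 1) := Nat.pow_le_pow_left h1 _
    _ = _ := by rw [← pow_mul, ← sq, pow_mul 2 2]; norm_num

lemma mem_GZ (D : ℕ) (g : Polynomial ℤ) (hd : g.natDegree ≤ D) (hc : ∀ i, |g.coeff i| ≤ 4 ^ D)
    (hβ : ∃ β : ℂ, Polynomial.aeval β g = 0 ∧ 2 ≤ ‖β‖ ^ (32 * D ^ 2)) : g ∈ GZ D := by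
  simp only [GZ, Finset.mem_filter, Finset.mem_image]
  refine ⟨⟨fun i => g.coeff i, ?_, ?_⟩, hβ⟩
  · rw [Fintype.mem_piFinset]
    intro i
    rw [Finset.mem_Icc]
    exact abs_le.1 (hc i)
  · rw [Fin.sum_univ_eq_sum_range (fun i => Polynomial.C (g.coeff i) * Polynomial.X ^ i)]
    exact (Polynomial.as_sum_range_C_mul_X_pow' g (by omega)).symm

open Classical in
lemma main_count (n D M m : ℕ) [Fact M.Prime] (hD : 1 ≤ D) (hn : ¬ 4 ∣ n + 1) (hM : 2 < M)
    (hKM : (2 * D ^ 2) * M ≤ n) (hm : (32 * D ^ 2) * m ≤ n) :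
    ((Bad n).card : ℝ) ≤ 2 ^ (n + 1) * (4 * (3 / 4) ^ (D + 1) + (2 * D ^ 2) ^ 2 / M ^ 3
      + 2 ^ (2 * (D + 1) ^ 2) / 2 ^ m) := by
  have hM0 : (0 : ℝ) < M := by exact_mod_cast (by omega : 0 < M)
  let A1 : Finset (Fin (n + 1) → Bool) :=
    ((Finset.Ico (D + 1) (n + 1)).filter (fun d => 2 * d ≤ n)).biUnion (fun d =>
      (G3 d).biUnion (fun g => Finset.univ.filter (fun x : Fin (n + 1) → Bool =>
      g ^ 2 ∣ (F n x).map (Int.castRingHom (ZMod 3)))))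
  let A2 : Finset (Fin (n + 1) → Bool) :=
    (Finset.Icc 2 (2 * D ^ 2)).biUnion (fun k =>
      ((Polynomial.nthRoots k (1 : ℂ)).toFinset.filter (fun z => z.im ≠ 0)).biUnion (fun z =>
        Finset.univ.filter (fun x : Fin (n + 1) → Bool => Polynomial.aeval z (F n x) = 0 ∧
      Polynomial.aeval z (Polynomial.derivative (F n x)) = 0)))
  let A3 : Finset (Fin (n + 1) → Bool) :=
    (GZ D).biUnion (fun g => Finset.univ.filter (fun x : Fin (n + 1) → Bool => g ∣ F n x))
  have hsub : Bad n ⊆ A1 ∪ (A2 ∪ A3) := by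
    intro x hx
    simp only [Bad, Finset.mem_filter, Finset.mem_univ, true_and] at hx
    obtain ⟨z, h, h'⟩ := hx
    rcases classify n D hD hn x z h h' with ⟨d, hd1, hd2, g, hg, hgd, hdv⟩ |
      ⟨k, hk1, hk2, hzk, him⟩ | ⟨g, hd, hc, hdv, hβ⟩
    · apply Finset.mem_union_left
      simp only [A1, Finset.mem_biUnion, Finset.mem_filter, Finset.mem_Ico, Finset.mem_univ,
        true_and]
      refine ⟨d, ⟨⟨by omega, by omega⟩, hd2⟩, g, ?_, hdv⟩
      rw [← hgd]; exact mem_G3 g hg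
    · apply Finset.mem_union_right
      apply Finset.mem_union_left
      simp only [A2, Finset.mem_biUnion, Finset.mem_filter, Finset.mem_Icc, Finset.mem_univ,
        true_and, Multiset.mem_toFinset]
      refine ⟨k, ⟨hk1, hk2⟩, z, ⟨?_, him⟩, h, h'⟩
      rw [Polynomial.mem_nthRoots (by omega)]
      exact hzk
    · apply Finset.mem_union_right
      apply Finset.mem_union_right
      simp only [A3, Finset.mem_biUnion, Finset.mem_filter, Finset.mem_univ, true_and]
      exact ⟨g, mem_GZ D g hd hc hβ, hdv⟩
  have b1 : (A1.card : ℝ) ≤ 2 ^ (n + 1) * (4 * (3 / 4) ^ (D + 1)) := by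
    have hd : ∀ d ∈ (Finset.Ico (D + 1) (n + 1)).filter (fun d => 2 * d ≤ n),
        (((G3 d).biUnion (fun g => Finset.univ.filter (fun x : Fin (n + 1) → Bool =>
      g ^ 2 ∣ (F n x).map (Int.castRingHom (ZMod 3))))).card : ℝ) ≤ 2 ^ (n + 1) * (3 / 4) ^ d := by
      intro d hd
      rw [Finset.mem_filter] at hd
      have h1 := biUnion_real (G3 d) (fun g => Finset.univ.filter (fun x : Fin (n + 1) → Bool =>
        g ^ 2 ∣ (F n x).map (Int.castRingHom (ZMod 3)))) (2 ^ (n + 1) / 4 ^ d) (by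
          intro g hg
          simp only [G3, Finset.mem_filter] at hg
          rw [le_div_iff₀ (by positivity)]
          have := count_mod3 n d hd.2 g hg.2.1 hg.2.2
          exact_mod_cast this)
      refine h1.trans ?_
      have h2 : ((G3 d).card : ℝ) ≤ 3 ^ d := by exact_mod_cast card_G3 d
      calc _ ≤ (3 : ℝ) ^ d * (2 ^ (n + 1) / 4 ^ d) := by gcongr
        _ = _ := by rw [div_pow]; ring
    calc (A1.card : ℝ) ≤ ((∑ d ∈ (Finset.Ico (D + 1) (n + 1)).filter (fun d => 2 * d ≤ n),
          ((G3 d).biUnion (fun g => Finset.univ.filter (fun x : Fin (n + 1) → Bool =>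
          g ^ 2 ∣ (F n x).map (Int.castRingHom (ZMod 3))))).card : ℕ) : ℝ) := by
          exact_mod_cast Finset.card_biUnion_le
      _ ≤ ∑ d ∈ (Finset.Ico (D + 1) (n + 1)).filter (fun d => 2 * d ≤ n),
          (2 : ℝ) ^ (n + 1) * (3 / 4) ^ d := by
          push_cast
          exact Finset.sum_le_sum hd
      _ ≤ ∑ d ∈ Finset.Ico (D + 1) (n + 1), (2 : ℝ) ^ (n + 1) * (3 / 4) ^ d :=
          Finset.sum_le_sum_of_subset_of_nonneg (Finset.filter_subset _ _)
            (fun _ _ _ => by positivity)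
      _ = (2 : ℝ) ^ (n + 1) * ∑ d ∈ Finset.Ico (D + 1) (n + 1), (3 / 4 : ℝ) ^ d := by
          rw [Finset.mul_sum]
      _ ≤ (2 : ℝ) ^ (n + 1) * ((3 / 4) ^ (D + 1) / (1 - 3 / 4)) := by
          gcongr
          exact geom_sum_Ico_le_of_lt_one (by norm_num) (by norm_num)
      _ = _ := by ring
  have b2 : (A2.card : ℝ) ≤ 2 ^ (n + 1) * ((2 * D ^ 2) ^ 2 / M ^ 3) := by
    have h1 := biUnion_real (Finset.Icc 2 (2 * D ^ 2)) (fun k =>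
      ((Polynomial.nthRoots k (1 : ℂ)).toFinset.filter (fun z => z.im ≠ 0)).biUnion (fun z =>
        Finset.univ.filter (fun x : Fin (n + 1) → Bool => Polynomial.aeval z (F n x) = 0 ∧
      Polynomial.aeval z (Polynomial.derivative (F n x)) = 0)))
      ((2 * D ^ 2) * (2 ^ (n + 1) / M ^ 3)) (by
        intro k hk
        rw [Finset.mem_Icc] at hk
        have h2 := biUnion_real
          ((Polynomial.nthRoots k (1 : ℂ)).toFinset.filter (fun z => z.im ≠ 0)) (fun z =>
          Finset.univ.filter (fun x : Fin (n + 1) → Bool => Polynomial.aeval z (F n x) = 0 ∧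
          Polynomial.aeval z (Polynomial.derivative (F n x)) = 0)) (2 ^ (n + 1) / M ^ 3) (by
            intro z hz
            rw [Finset.mem_filter, Multiset.mem_toFinset, Polynomial.mem_nthRoots (by omega)] at hz
            rw [le_div_iff₀ (by positivity)]
            have := count_unity n M k hM hk.1
              ((Nat.mul_le_mul_right M hk.2).trans hKM) z hz.2 hz.1
            exact_mod_cast this)
        refine h2.trans ?_
        gcongr
        have h3 : ((Polynomial.nthRoots k (1 : ℂ)).toFinset.filter (fun z => z.im ≠ 0)).card
            ≤ 2 * D ^ 2 :=
          (Finset.card_filter_le _ _).trans ((Multiset.toFinset_card_le _).trans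
            ((Polynomial.card_nthRoots _ _).trans hk.2))
        exact_mod_cast h3)
    refine h1.trans ?_
    have h4 : ((Finset.Icc 2 (2 * D ^ 2)).card : ℝ) ≤ 2 * D ^ 2 := by
      have : (Finset.Icc 2 (2 * D ^ 2)).card ≤ 2 * D ^ 2 := by rw [Nat.card_Icc]; omega
      exact_mod_cast this
    calc _ ≤ (2 * (D : ℝ) ^ 2) * ((2 * D ^ 2) * (2 ^ (n + 1) / M ^ 3)) := by gcongr
      _ = _ := by ring
  have b3 : (A3.card : ℝ) ≤ 2 ^ (n + 1) * (2 ^ (2 * (D + 1) ^ 2) / 2 ^ m) := by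
    have h1 := biUnion_real (GZ D)
      (fun g => Finset.univ.filter (fun x : Fin (n + 1) → Bool => g ∣ F n x))
      (2 ^ (n + 1) / 2 ^ m) (by
        intro g hg
        simp only [GZ, Finset.mem_filter] at hg
        obtain ⟨-, β, hβ, hβ2⟩ := hg
        rw [le_div_iff₀ (by positivity)]
        have h2 := count_big n m (32 * D ^ 2) (by positivity) hm β hβ2
        have h3 : (Finset.univ.filter (fun x : Fin (n + 1) → Bool => g ∣ F n x)).card ≤
          (Finset.univ.filter (fun x : Fin (n + 1) → Bool =>
            Polynomial.aeval β (F n x) = 0)).card := by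
          apply Finset.card_le_card
          intro x hx
          simp only [Finset.mem_filter, Finset.mem_univ, true_and] at hx ⊢
          obtain ⟨q, hq⟩ := hx
          rw [hq, map_mul, hβ, zero_mul]
        have h4 := (Nat.mul_le_mul_right (2 ^ m) h3).trans h2
        exact_mod_cast h4)
    refine h1.trans ?_
    have h2 : ((GZ D).card : ℝ) ≤ 2 ^ (2 * (D + 1) ^ 2) := by exact_mod_cast card_GZ D
    calc _ ≤ (2 : ℝ) ^ (2 * (D + 1) ^ 2) * (2 ^ (n + 1) / 2 ^ m) := by gcongr
      _ = _ := by ring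
  have htot : ((Bad n).card : ℝ) ≤ A1.card + (A2.card + A3.card) := by
    have h1 := (Finset.card_le_card hsub).trans (Finset.card_union_le _ _)
    have h2 := Finset.card_union_le A2 A3
    have : (Bad n).card ≤ A1.card + (A2.card + A3.card) := by omega
    exact_mod_cast this
  linarith

/-- final upper bound as a function of the 20th root of `n` -/
noncomputable def G (r : ℕ) : ℝ :=
  4 * ((r + 1 : ℕ) ^ 40 * (3 / 4 : ℝ) ^ (r + 1)) + 256 * (1 / (r : ℝ)) ^ 10
    + 2 * ((r + 1 : ℕ) ^ 40 * (1 / 2 : ℝ) ^ (r + 1))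

lemma G_tendsto : Tendsto G atTop (nhds 0) := by
  have h1 : Tendsto (fun r : ℕ => ((r + 1 : ℕ) : ℝ) ^ 40 * (3 / 4 : ℝ) ^ (r + 1)) atTop (nhds 0) :=
    (tendsto_pow_const_mul_const_pow_of_abs_lt_one 40
      (show |(3 / 4 : ℝ)| < 1 by rw [abs_lt]; constructor <;> norm_num)).comp (tendsto_add_atTop_nat 1)
  have h2 : Tendsto (fun r : ℕ => ((r + 1 : ℕ) : ℝ) ^ 40 * (1 / 2 : ℝ) ^ (r + 1)) atTop (nhds 0) :=
    (tendsto_pow_const_mul_const_pow_of_abs_lt_one 40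
      (show |(1 / 2 : ℝ)| < 1 by rw [abs_lt]; constructor <;> norm_num)).comp (tendsto_add_atTop_nat 1)
  have h3 : Tendsto (fun r : ℕ => (1 / (r : ℝ)) ^ 10) atTop (nhds 0) := by
    have := (tendsto_one_div_atTop_nhds_zero_nat (𝕜 := ℝ)).pow 10
    simpa using this
  have := ((h1.const_mul 4).add (h3.const_mul 256)).add (h2.const_mul 2)
  simp only [mul_zero, add_zero] at this
  exact this

lemma t2_aux (n r M : ℝ) (hn : 0 < n) (hr : 0 < r) (hM : 0 < M) (h20 : r ^ 20 ≤ n)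
    (hMn : n ≤ 4 * r ^ 2 * M) : n ^ 2 * ((2 * r ^ 2) ^ 2 / M ^ 3) ≤ 256 * (1 / r) ^ 10 := by
  have e1 : n ^ 3 ≤ (4 * r ^ 2 * M) ^ 3 := pow_le_pow_left₀ hn.le hMn 3
  have e2 : r ^ 20 * n ^ 2 ≤ (4 * r ^ 2 * M) ^ 3 := by
    calc _ ≤ n * n ^ 2 := mul_le_mul_of_nonneg_right h20 (by positivity)
      _ = n ^ 3 := by ring
      _ ≤ _ := e1
  have e3 : n ^ 2 * (2 * r ^ 2) ^ 2 * r ^ 10 ≤ 256 * M ^ 3 := by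
    have h6 : r ^ 6 * (n ^ 2 * (2 * r ^ 2) ^ 2 * r ^ 10) ≤ r ^ 6 * (256 * M ^ 3) := by
      calc r ^ 6 * (n ^ 2 * (2 * r ^ 2) ^ 2 * r ^ 10) = 4 * (r ^ 20 * n ^ 2) := by ring
        _ ≤ 4 * (4 * r ^ 2 * M) ^ 3 := mul_le_mul_of_nonneg_left e2 (by norm_num)
        _ = _ := by ring
    exact le_of_mul_le_mul_left h6 (by positivity)
  have e4 : n ^ 2 * ((2 * r ^ 2) ^ 2 / M ^ 3) = (n ^ 2 * (2 * r ^ 2) ^ 2) / M ^ 3 := by ring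
  have e5 : 256 * (1 / r) ^ 10 = 256 / r ^ 10 := by rw [one_div, inv_pow, div_eq_mul_inv]
  rw [e4, e5, div_le_div_iff₀ (by positivity) (by positivity)]
  exact e3

lemma fin_aux (N L P a b c a' b' c' : ℝ) (hN : 0 ≤ N) (hP : 0 < P) (hL : L ≤ P * (a + b + c))
    (h1 : N * a ≤ a') (h2 : N * b ≤ b') (h3 : N * c ≤ c') : N * L / P ≤ a' + b' + c' := by
  rw [div_le_iff₀ hP]
  calc N * L ≤ N * (P * (a + b + c)) := mul_le_mul_of_nonneg_left hL hN
    _ = (N * a + N * b + N * c) * P := by ring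
    _ ≤ (a' + b' + c') * P := mul_le_mul_of_nonneg_right (by linarith) hP.le

set_option maxHeartbeats 1000000 in
lemma bound_r (n r : ℕ) (hr : 2 ≤ r) (hn : ¬ 4 ∣ n + 1) (h1 : r ^ 20 ≤ n) (h2 : n < (r + 1) ^ 20) :
    (n : ℝ) ^ 2 * (littlewoodDoubleRootCount n : ℝ) / 2 ^ (n + 1) ≤ G r := by
  have hr2 : 4 ≤ r ^ 2 := by nlinarith
  have h16 : 65536 ≤ r ^ 16 := by
    have := Nat.pow_le_pow_left hr 16
    norm_num at this
    exact this
  have hnr : 65536 * r ^ 4 ≤ n := by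
    calc 65536 * r ^ 4 ≤ r ^ 16 * r ^ 4 := Nat.mul_le_mul_right _ h16
      _ = r ^ 20 := by ring
      _ ≤ n := h1
  obtain ⟨q, hq⟩ : ∃ q, q = n / (4 * r ^ 2) := ⟨_, rfl⟩
  have hq2 : 2 ≤ q := by
    rw [hq, Nat.le_div_iff_mul_le (by positivity)]
    calc 2 * (4 * r ^ 2) = 8 * r ^ 2 := by ring
      _ ≤ 65536 * r ^ 4 := Nat.mul_le_mul (by norm_num) (Nat.pow_le_pow_right (by omega) (by norm_num))
      _ ≤ n := hnr
  obtain ⟨M, hMp, hM1, hM2⟩ := Nat.exists_prime_lt_and_le_two_mul q (by omega)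
  have : Fact M.Prime := ⟨hMp⟩
  have hKM : (2 * r ^ 2) * M ≤ n := by
    calc (2 * r ^ 2) * M ≤ (2 * r ^ 2) * (2 * q) := Nat.mul_le_mul_left _ hM2
      _ = n / (4 * r ^ 2) * (4 * r ^ 2) := by rw [hq]; ring
      _ ≤ n := Nat.div_mul_le_self _ _
  obtain ⟨m, hmdef⟩ : ∃ m, m = n / (32 * r ^ 2) := ⟨_, rfl⟩
  have hm : (32 * r ^ 2) * m ≤ n := hmdef ▸ Nat.mul_div_le _ _
  have hm2 : 2 * (r + 1) ^ 2 + r ≤ m := by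
    rw [hmdef, Nat.le_div_iff_mul_le (by positivity)]
    have : 2 * (r + 1) ^ 2 + r ≤ 9 * r ^ 2 := by nlinarith
    calc (2 * (r + 1) ^ 2 + r) * (32 * r ^ 2) ≤ 9 * r ^ 2 * (32 * r ^ 2) :=
          Nat.mul_le_mul_right _ this
      _ = 288 * r ^ 4 := by ring
      _ ≤ n := (Nat.mul_le_mul_right _ (by norm_num)).trans hnr
  have hmain := main_count n r M m (by omega) hn (by omega) hKM hm
  have hL : (littlewoodDoubleRootCount n : ℝ) ≤ (Bad n).card := by exact_mod_cast count_eq n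
  have hr0 : (0 : ℝ) < r := by exact_mod_cast (by omega : 0 < r)
  have hn0 : (0 : ℝ) < n := by
    have : 0 < n := lt_of_lt_of_le (by positivity) hnr
    exact_mod_cast this
  have hMn : (n : ℝ) ≤ 4 * r ^ 2 * M := by
    have : n < 4 * r ^ 2 * (q + 1) := hq ▸ Nat.lt_mul_div_succ n (by positivity)
    have h3 : 4 * r ^ 2 * (q + 1) ≤ 4 * r ^ 2 * M := Nat.mul_le_mul_left _ hM1
    exact_mod_cast (this.le.trans h3)
  have hM0 : (0 : ℝ) < M := by exact_mod_cast hMp.pos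
  have hn40 : (n : ℝ) ^ 2 ≤ ((r + 1 : ℕ) : ℝ) ^ 40 := by
    have : n ^ 2 ≤ (r + 1) ^ 40 := by
      calc n ^ 2 ≤ ((r + 1) ^ 20) ^ 2 := Nat.pow_le_pow_left h2.le 2
        _ = _ := by ring
    exact_mod_cast this
  have t1 : (n : ℝ) ^ 2 * (4 * (3 / 4) ^ (r + 1)) ≤
      4 * ((r + 1 : ℕ) ^ 40 * (3 / 4 : ℝ) ^ (r + 1)) := by
    have := mul_le_mul_of_nonneg_right hn40 (show (0 : ℝ) ≤ 4 * (3 / 4) ^ (r + 1) by positivity)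
    refine this.trans (le_of_eq ?_)
    rw [mul_left_comm]
  have t2 : (n : ℝ) ^ 2 * ((2 * r ^ 2) ^ 2 / M ^ 3) ≤ 256 * (1 / (r : ℝ)) ^ 10 :=
    t2_aux n r M hn0 hr0 hM0 (by exact_mod_cast h1) hMn
  have t3 : (n : ℝ) ^ 2 * (2 ^ (2 * (r + 1) ^ 2) / 2 ^ m) ≤
      2 * ((r + 1 : ℕ) ^ 40 * (1 / 2 : ℝ) ^ (r + 1)) := by
    have e1 : (2 : ℝ) ^ (2 * (r + 1) ^ 2) / 2 ^ m ≤ (1 / 2) ^ r := by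
      rw [div_le_iff₀ (by positivity), one_div, inv_pow, inv_mul_eq_div, le_div_iff₀ (by positivity),
        ← pow_add]
      exact pow_le_pow_right₀ (by norm_num) hm2
    have e2 : (n : ℝ) ^ 2 * (2 ^ (2 * (r + 1) ^ 2) / 2 ^ m) ≤
        ((r + 1 : ℕ) : ℝ) ^ 40 * (1 / 2) ^ r :=
      mul_le_mul hn40 e1 (by positivity) (by positivity)
    refine e2.trans (le_of_eq ?_)
    rw [pow_succ (1 / 2 : ℝ)]
    generalize ((r + 1 : ℕ) : ℝ) ^ 40 = y
    ring
  exact fin_aux _ _ _ _ _ _ _ _ _ (sq_nonneg _) (pow_pos two_pos _) (hL.trans hmain) t1 t2 t3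

lemma exists_root (n : ℕ) : ∃ r : ℕ, r ^ 20 ≤ n ∧ n < (r + 1) ^ 20 := by
  have hex : ∃ s : ℕ, n < (s + 1) ^ 20 :=
    ⟨n, lt_of_lt_of_le (Nat.lt_succ_self n) (Nat.le_self_pow (by norm_num) _)⟩
  refine ⟨Nat.find hex, ?_, Nat.find_spec hex⟩
  rcases Nat.eq_zero_or_pos (Nat.find hex) with h | h
  · rw [h]; simp
  · have := Nat.find_min hex (m := Nat.find hex - 1) (by omega)
    rw [Nat.sub_add_cancel h] at this
    omega

end LW

/-- Along `n` with `n + 1` not divisible by `4`, the probability that a random Littlewood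
polynomial of degree `n` has a double root is `o(n⁻²)`. -/
theorem littlewood_double_root_not_div_four :
    Tendsto (fun n : ℕ => (n : ℝ) ^ 2 * (littlewoodDoubleRootCount n : ℝ) / 2 ^ (n + 1))
      (atTop ⊓ Filter.principal {n : ℕ | ¬ (4 ∣ n + 1)}) (nhds 0) := by
  choose r hr1 hr2 using LW.exists_root
  have hr : Tendsto r atTop atTop := by
    rw [tendsto_atTop]
    intro b
    filter_upwards [eventually_ge_atTop (b ^ 20)] with n hn
    by_contra hlt
    have h1 : (r n + 1) ^ 20 ≤ b ^ 20 := Nat.pow_le_pow_left (by omega) 20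
    have := hr2 n
    omega
  refine tendsto_of_tendsto_of_tendsto_of_le_of_le' tendsto_const_nhds
    ((LW.G_tendsto.comp hr).mono_left inf_le_left) ?_ ?_
  · exact Eventually.of_forall fun n => by positivity
  · rw [eventually_inf_principal]
    filter_upwards [hr.eventually_ge_atTop 2] with n hn hn4
    exact LW.bound_r n (r n) hn hn4 (hr1 n) (hr2 n)
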